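/- Let K ⊆ ℝⁿ be a measurable set, let I be a finite set of multi-indices α ∈ ℕⁿ, and let m : I → ℝ be given moment values. Let P denote the set of probability densities f on K such that f·ln f is integrable over K, every monomial x ↦ x^α (α ∈ I) is integrable against f over K, and ∫_K x^α f(x) dx = m_α for all α ∈ I. If p and q both belong to P and both maximize the entropy H(f) = -∫_K f(x) ln f(x) dx over P, then p = q Lebesgue-almost-everywhere on K. -/

import Mathlib

open MeasureTheory Real

/-- `f` is a probability density on `K` (w.r.t. Lebesgue measure). -/
def IsDensityOn {n : ℕ} (K : Set (Fin n → ℝ)) (f : (Fin n → ℝ) → ℝ) : Prop :=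
  Measurable f ∧ (∀ x, 0 ≤ f x) ∧ (∀ x ∉ K, f x = 0) ∧ (∫ x in K, f x) = 1

/-- `f` belongs to the constraint set `P`: it is a density on `K` with integrable
entropy integrand, every monomial `x^α` (`α ∈ I`) is integrable against `f` over `K`,
and the moments of `f` match the prescribed values `m α`. -/
def MemMomentSet {n : ℕ} (K : Set (Fin n → ℝ)) (I : Finset (Fin n → ℕ))
    (m : (Fin n → ℕ) → ℝ) (f : (Fin n → ℝ) → ℝ) : Prop :=
  IsDensityOn K f ∧
  IntegrableOn (fun x => f x * Real.log (f x)) K volume ∧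
  (∀ α ∈ I, IntegrableOn (fun x => (∏ i, x i ^ α i) * f x) K volume) ∧
  (∀ α ∈ I, (∫ x in K, (∏ i, x i ^ α i) * f x) = m α)

/-- A lower bound for `t log t` at a midpoint: mixing lowers `∑ t log t` by at most `log 2`
per unit of mass. -/
lemma le_midpoint_mul_log {a b : ℝ} (ha : 0 ≤ a) (hb : 0 ≤ b) :
    (a * log a + b * log b) / 2 - log 2 * ((a + b) / 2) ≤
      (a + b) / 2 * log ((a + b) / 2) := by
  have key : ∀ {s t : ℝ}, 0 ≤ s → 0 ≤ t → s * (log s - log 2) ≤ s * log ((s + t) / 2) := by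
    intro s t hs ht
    rcases hs.eq_or_lt with rfl | hs
    · simp
    · rw [← log_div hs.ne' two_ne_zero]
      gcongr
      linarith
  have h₁ := key ha hb
  have h₂ := key hb ha
  rw [add_comm b a] at h₂
  linarith

lemma midpoint_mul_log_le {a b : ℝ} (ha : 0 ≤ a) (hb : 0 ≤ b) :
    (a + b) / 2 * log ((a + b) / 2) ≤ (a * log a + b * log b) / 2 := by
  have h := convexOn_mul_log.2 (Set.mem_Ici.2 ha) (Set.mem_Ici.2 hb)
    (by norm_num : (0 : ℝ) ≤ 1 / 2) (by norm_num : (0 : ℝ) ≤ 1 / 2) (by norm_num)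
  simp only [smul_eq_mul] at h
  rw [show 1 / 2 * a + 1 / 2 * b = (a + b) / 2 by ring] at h
  linarith

lemma midpoint_mul_log_lt {a b : ℝ} (ha : 0 ≤ a) (hb : 0 ≤ b) (hab : a ≠ b) :
    (a + b) / 2 * log ((a + b) / 2) < (a * log a + b * log b) / 2 := by
  have h := strictConvexOn_mul_log.2 (Set.mem_Ici.2 ha) (Set.mem_Ici.2 hb) hab
    (by norm_num : (0 : ℝ) < 1 / 2) (by norm_num : (0 : ℝ) < 1 / 2) (by norm_num)
  simp only [smul_eq_mul] at h
  rw [show 1 / 2 * a + 1 / 2 * b = (a + b) / 2 by ring] at h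
  linarith

lemma IsDensityOn.integrableOn {n : ℕ} {K : Set (Fin n → ℝ)} {f : (Fin n → ℝ) → ℝ}
    (hf : IsDensityOn K f) : IntegrableOn f K volume :=
  Integrable.of_integral_ne_zero (by rw [hf.2.2.2]; exact one_ne_zero)

lemma IsDensityOn.midpoint {n : ℕ} {K : Set (Fin n → ℝ)} {p q : (Fin n → ℝ) → ℝ}
    (hp : IsDensityOn K p) (hq : IsDensityOn K q) :
    IsDensityOn K (fun x => (p x + q x) / 2) := by
  refine ⟨(hp.1.add hq.1).div_const 2, fun x => ?_, fun x hx => ?_, ?_⟩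
  · have := hp.2.1 x
    have := hq.2.1 x
    positivity
  · simp [hp.2.2.1 x hx, hq.2.2.1 x hx]
  · rw [integral_div, integral_add hp.integrableOn hq.integrableOn, hp.2.2.2, hq.2.2.2]
    norm_num

lemma MemMomentSet.midpoint {n : ℕ} {K : Set (Fin n → ℝ)} {I : Finset (Fin n → ℕ)}
    {m : (Fin n → ℕ) → ℝ} {p q : (Fin n → ℝ) → ℝ}
    (hp : MemMomentSet K I m p) (hq : MemMomentSet K I m q) :
    MemMomentSet K I m (fun x => (p x + q x) / 2) := by
  obtain ⟨hpd, hpe, hpi, hpm⟩ := hp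
  obtain ⟨hqd, hqe, hqi, hqm⟩ := hq
  have hd := hpd.midpoint hqd
  have hsplit : ∀ α : Fin n → ℕ, (fun x : Fin n → ℝ => (∏ i, x i ^ α i) * ((p x + q x) / 2)) =
      fun x => ((∏ i, x i ^ α i) * p x + (∏ i, x i ^ α i) * q x) / 2 := fun α => by
    ext x
    ring
  refine ⟨hd, ?_, fun α hα => ?_, fun α hα => ?_⟩
  · exact integrable_of_le_of_le (hd.1.mul hd.1.log).aestronglyMeasurable
      (ae_of_all _ fun x => le_midpoint_mul_log (hpd.2.1 x) (hqd.2.1 x))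
      (ae_of_all _ fun x => midpoint_mul_log_le (hpd.2.1 x) (hqd.2.1 x))
      (((hpe.add hqe).div_const 2).sub (hd.integrableOn.const_mul (log 2)))
      ((hpe.add hqe).div_const 2)
  · rw [hsplit]
    exact ((hpi α hα).add (hqi α hα)).div_const 2
  · rw [hsplit, integral_div, integral_add (hpi α hα) (hqi α hα), hpm α hα, hqm α hα]
    ring

/-- **Uniqueness of the Moment-Constrained Max-Entropy Distribution.**
If `p` and `q` both match the prescribed moments and both maximize the entropy
`H(f) = -∫_K f ln f` over the constraint set, then `p = q` Lebesgue-a.e. on `K`. -/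
theorem maxEntropy_unique {n : ℕ} (K : Set (Fin n → ℝ)) (hK : MeasurableSet K)
    (I : Finset (Fin n → ℕ)) (m : (Fin n → ℕ) → ℝ)
    (p q : (Fin n → ℝ) → ℝ)
    (hp : MemMomentSet K I m p) (hq : MemMomentSet K I m q)
    (hpMax : ∀ f, MemMomentSet K I m f →
      (-∫ x in K, f x * Real.log (f x)) ≤ (-∫ x in K, p x * Real.log (p x)))
    (hqMax : ∀ f, MemMomentSet K I m f →
      (-∫ x in K, f x * Real.log (f x)) ≤ (-∫ x in K, q x * Real.log (q x))) :
    p =ᵐ[volume.restrict K] q := by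
  have hf := hp.midpoint hq
  have hfe : IntegrableOn (fun x => (p x + q x) / 2 * log ((p x + q x) / 2)) K volume := hf.2.1
  have hpq : IntegrableOn (fun x => (p x * log (p x) + q x * log (q x)) / 2) K volume :=
    (hp.2.1.add hq.2.1).div_const 2
  have hnonneg : 0 ≤ᵐ[volume.restrict K] fun x => (p x * log (p x) + q x * log (q x)) / 2 -
      (p x + q x) / 2 * log ((p x + q x) / 2) :=
    ae_of_all _ fun x => sub_nonneg.2 (midpoint_mul_log_le (hp.1.2.1 x) (hq.1.2.1 x))
  have hle : (∫ x in K, ((p x * log (p x) + q x * log (q x)) / 2 -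
      (p x + q x) / 2 * log ((p x + q x) / 2))) ≤ 0 := by
    have h₁ := hpMax _ hf
    have h₂ := hqMax _ hf
    rw [integral_sub hpq hfe, integral_div, integral_add hp.2.1 hq.2.1]
    linarith
  have hzero := (integral_eq_zero_iff_of_nonneg_ae hnonneg (hpq.sub hfe)).1
    (le_antisymm hle (integral_nonneg_of_ae hnonneg))
  filter_upwards [hzero] with x hx
  by_contra hne
  exact (sub_pos.2 (midpoint_mul_log_lt (hp.1.2.1 x) (hq.1.2.1 x) hne)).ne' hx
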